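/- The mat statistic gives the q-hit polynomials: for any Ferrers board B in the n×n grid, T_k(B;q) = Σ_C q^{mat(C,B)}, where the sum is over placements C of n non-attacking rooks on the n×n grid with exactly k rooks on B, mat(C,B) := n(n-k) + Area(B) - cross(C,B), and cross(C,B) is the number of grid squares that either contain a rook, or lie to the right of a rook in its row, or lie above a rook in its column and belong to B, or lie below a rook (in its column) whose rook is off B. -/

import Mathlib

open Finset
open scoped Classical

noncomputable section

variable {R : Type*} [CommRing R]

/-- The q-integer `[m]_q = 1 + q + ... + q^{m-1}`. -/
def qint (q : R) (m : ℕ) : R := ∑ i ∈ Finset.range m, q ^ i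

/-- The q-factorial `[m]_q!`. -/
def qfact (q : R) (m : ℕ) : R := ∏ i ∈ Finset.range m, qint q (i + 1)

/-- A Ferrers board inside the `n × n` grid, given by column heights `c`:
square `(i,j)` (0-based row `i`, column `j`) belongs to the board iff `i < c j`. -/
def IsFerrers (n : ℕ) (c : Fin n → ℕ) : Prop := Monotone c ∧ ∀ j, c j ≤ n

/-- The squares of the Ferrers board with column heights `c`. -/
def boardSq (n : ℕ) (c : Fin n → ℕ) : Finset (Fin n × Fin n) :=
  Finset.univ.filter fun s => (s.1 : ℕ) < c s.2

/-- A set of rooks is non-attacking when no two share a row or a column. -/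
def NonAttacking {n : ℕ} (C : Finset (Fin n × Fin n)) : Prop :=
  ∀ r ∈ C, ∀ r' ∈ C, r ≠ r' → r.1 ≠ r'.1 ∧ r.2 ≠ r'.2

/-- Placements of `k` non-attacking rooks on the Ferrers board. -/
def placements (n : ℕ) (c : Fin n → ℕ) (k : ℕ) : Finset (Finset (Fin n × Fin n)) :=
  Finset.univ.filter fun C => C.card = k ∧ C ⊆ boardSq n c ∧ NonAttacking C

/-- `inv(C,B)`: the number of squares of the board that do not contain a rook and
are not above (smaller row index, same column) nor to the right of (same row,
larger column index) any rook of `C`. -/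
def rookInv (n : ℕ) (c : Fin n → ℕ) (C : Finset (Fin n × Fin n)) : ℕ :=
  ((boardSq n c).filter fun s => s ∉ C ∧ ∀ r ∈ C,
    ¬(r.2 = s.2 ∧ s.1 < r.1) ∧ ¬(r.1 = s.1 ∧ r.2 < s.2)).card

/-- The Garsia–Remmel q-rook polynomial `R_k(B;q)`. -/
def qRook (q : R) (n : ℕ) (c : Fin n → ℕ) (k : ℕ) : R :=
  ∑ C ∈ placements n c k, q ^ rookInv n c C

/-- The polynomial (in `x`) `∑_{j=0}^n [j]_q! R_{n-j}(B;q) ∏_{i=j+1}^n (x - q^i)`. -/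
def hitGen (q : R) (n : ℕ) (c : Fin n → ℕ) : Polynomial R :=
  ∑ j ∈ Finset.range (n + 1),
    Polynomial.C (qfact q j * qRook q n c (n - j)) *
      ∏ i ∈ Finset.Icc (j + 1) n, (Polynomial.X - Polynomial.C (q ^ i))

/-- The Garsia–Remmel q-hit polynomial `T_k(B;q)`, defined by
`∑_{j=0}^n [j]_q! R_{n-j}(B;q) ∏_{i=j+1}^n (x - q^i) = ∑_k T_k(B;q) x^k`. -/
def qHit (q : R) (n : ℕ) (c : Fin n → ℕ) (k : ℕ) : R := (hitGen q n c).coeff k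

/-- Placements of `n` non-attacking rooks on the full `n × n` grid with exactly
`k` rooks on the board. -/
def fullPlacements (n : ℕ) (c : Fin n → ℕ) (k : ℕ) : Finset (Finset (Fin n × Fin n)) :=
  Finset.univ.filter fun C => C.card = n ∧ NonAttacking C ∧ (C ∩ boardSq n c).card = k

end

open scoped Classical in
/-- The statistic `cross(C,B)`: grid squares containing a rook, or to the right of a
rook, or above a rook and on `B`, or below a rook which is off `B`. -/
noncomputable def crossStat (n : ℕ) (c : Fin n → ℕ) (C : Finset (Fin n × Fin n)) : ℕ :=
  (Finset.univ.filter fun s : Fin n × Fin n =>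
    s ∈ C ∨ (∃ r ∈ C, r.1 = s.1 ∧ r.2 < s.2) ∨
      (s ∈ boardSq n c ∧ ∃ r ∈ C, r.2 = s.2 ∧ s.1 < r.1) ∨
      (∃ r ∈ C, r ∉ boardSq n c ∧ r.2 = s.2 ∧ r.1 < s.1)).card

/-- The `q`-rook numbers of the board with column heights `c 0, …, c (t - 1)`, computed by adding
the columns from left to right. -/
noncomputable def rookRec {R : Type*} [CommRing R] (q : R) (c : ℕ → ℕ) : ℕ → ℕ → R
  | 0, 0 => 1
  | 0, _ + 1 => 0
  | t + 1, 0 => q ^ c t * rookRec q c t 0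
  | t + 1, k + 1 =>
    q ^ (c t - (k + 1)) * rookRec q c t (k + 1) + qint q (c t - k) * rookRec q c t k

/-- Remove the last square of column `p`. -/
def lowerCol (c : ℕ → ℕ) (p : ℕ) : ℕ → ℕ := fun j => if j = p then c p - 1 else c j

/-- Delete column `p` together with the row of its last square, when that square is leftmost in
its row. -/
def contractCol (c : ℕ → ℕ) (p : ℕ) : ℕ → ℕ := fun j => if j < p then c j else c (j + 1) - 1

/-- Delete column `0` and row `i`. -/
def deleteRow (c : ℕ → ℕ) (i : ℕ) : ℕ → ℕ :=
  fun j => c (j + 1) - if i < c (j + 1) then 1 else 0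

section RookRec

variable {R : Type*} [CommRing R] (q : R)

lemma qint_zero : qint q 0 = 0 := by simp [qint]

lemma qint_succ (m : ℕ) : qint q (m + 1) = q * qint q m + 1 := by
  simp [qint, Finset.sum_range_succ', Finset.mul_sum, pow_succ']

lemma qint_add (a b : ℕ) : qint q (a + b) = qint q a + q ^ a * qint q b := by
  simp [qint, Finset.sum_range_add, Finset.mul_sum, pow_add]

lemma qfact_succ (m : ℕ) : qfact q (m + 1) = qfact q m * qint q (m + 1) := by
  simp [qfact, Finset.prod_range_succ]

lemma rookRec_succ_succ (c : ℕ → ℕ) (t k : ℕ) : rookRec q c (t + 1) (k + 1) =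
    q ^ (c t - (k + 1)) * rookRec q c t (k + 1) + qint q (c t - k) * rookRec q c t k :=
  rfl

lemma rookRec_succ_zero (c : ℕ → ℕ) (t : ℕ) :
    rookRec q c (t + 1) 0 = q ^ c t * rookRec q c t 0 :=
  rfl

lemma rookRec_congr {c d : ℕ → ℕ} {t : ℕ} (h : ∀ j < t, c j = d j) (k : ℕ) :
    rookRec q c t k = rookRec q d t k := by
  induction t generalizing k with
  | zero => cases k <;> simp [rookRec]
  | succ t ih =>
    have ih' := ih fun j hj => h j (hj.trans t.lt_succ_self)
    cases k <;> simp [rookRec, ih', h t t.lt_succ_self]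

lemma rookRec_eq_zero {c : ℕ → ℕ} {t k : ℕ} (hk : 0 < k) (h : ∀ j < t, c j < k) :
    rookRec q c t k = 0 := by
  induction t with
  | zero => obtain ⟨k, rfl⟩ := Nat.exists_eq_succ_of_ne_zero hk.ne'; simp [rookRec]
  | succ t ih =>
    have ih' := ih fun j hj => h j (hj.trans t.lt_succ_self)
    obtain ⟨k, rfl⟩ := Nat.exists_eq_succ_of_ne_zero hk.ne'
    have : c t - k = 0 := by have := h t t.lt_succ_self; omega
    simp [rookRec, ih', this, qint_zero]

lemma rookRec_zero_lowerCol {c : ℕ → ℕ} {t p : ℕ} (hp : p < t) (h0 : 0 < c p) :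
    rookRec q c t 0 = q * rookRec q (lowerCol c p) t 0 := by
  induction t with
  | zero => omega
  | succ t ih =>
    rcases eq_or_ne p t with rfl | hne
    · have h1 : rookRec q (lowerCol c p) p 0 = rookRec q c p 0 :=
        rookRec_congr q (fun j hj => by simp [lowerCol, hj.ne]) 0
      obtain ⟨a, ha⟩ := Nat.exists_eq_succ_of_ne_zero h0.ne'
      simp only [rookRec, h1]
      simp only [lowerCol, if_true, ha, Nat.succ_eq_add_one, Nat.add_sub_cancel]
      ring
    · have := ih (by omega)
      simp only [rookRec, this]
      simp only [lowerCol, if_neg hne.symm]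
      ring

lemma rookRec_succ_lowerCol {c : ℕ → ℕ} {t p : ℕ} (hp : p < t + 1)
    (h0 : 0 < c p) (hl : ∀ j < p, c j < c p) (k : ℕ) :
    rookRec q c (t + 1) (k + 1) =
      q * rookRec q (lowerCol c p) (t + 1) (k + 1) + rookRec q (contractCol c p) t k := by
  induction t generalizing k with
  | zero =>
    obtain rfl : p = 0 := by omega
    obtain ⟨a, ha⟩ := Nat.exists_eq_succ_of_ne_zero h0.ne'
    cases k <;> simp [rookRec, lowerCol, ha, qint_succ]
  | succ t ih =>
    rcases eq_or_ne p (t + 1) with rfl | hne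
    · have h1 (k) : rookRec q (lowerCol c (t + 1)) (t + 1) k = rookRec q c (t + 1) k :=
        rookRec_congr q (fun j hj => by simp [lowerCol, hj.ne]) k
      have h2 (k) : rookRec q (contractCol c (t + 1)) (t + 1) k = rookRec q c (t + 1) k :=
        rookRec_congr q (fun j hj => by simp [contractCol, hj]) k
      obtain ⟨a, ha⟩ := Nat.exists_eq_succ_of_ne_zero h0.ne'
      rw [rookRec_succ_succ q c (t + 1), rookRec_succ_succ q (lowerCol c _), h1, h1, h2]
      simp only [lowerCol, if_true, ha, Nat.succ_eq_add_one, Nat.add_sub_cancel]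
      rcases lt_trichotomy k a with h | rfl | h
      · rw [show a + 1 - (k + 1) = (a - (k + 1)) + 1 by omega,
          show a + 1 - k = (a - k) + 1 by omega, qint_succ]
        ring
      · have : rookRec q c (t + 1) (k + 1) = 0 :=
          rookRec_eq_zero q (by omega) fun j hj => by have := hl j hj; omega
        simp [this, qint_zero, qint_succ]
      · have z1 : rookRec q c (t + 1) (k + 1) = 0 :=
          rookRec_eq_zero q (by omega) fun j hj => by have := hl j hj; omega
        have z2 : rookRec q c (t + 1) k = 0 :=
          rookRec_eq_zero q (by omega) fun j hj => by have := hl j hj; omega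
        simp [z1, z2]
    · have hpt : p < t + 1 := by omega
      have ih := ih hpt
      have hL : lowerCol c p (t + 1) = c (t + 1) := by simp [lowerCol, hne.symm]
      have hC : contractCol c p t = c (t + 1) - 1 := by
        simp [contractCol, show ¬ t < p by omega]
      rw [rookRec_succ_succ q c, rookRec_succ_succ q (lowerCol c p), hL]
      cases k with
      | zero =>
        rw [ih, rookRec_zero_lowerCol q hpt h0, rookRec_succ_zero q (contractCol c p), hC]
        simp only [zero_add]
        ring
      | succ k =>
        rw [ih, ih, rookRec_succ_succ q (contractCol c p), hC,
          show c (t + 1) - 1 - (k + 1) = c (t + 1) - (k + 1 + 1) by omega,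
          show c (t + 1) - 1 - k = c (t + 1) - (k + 1) by omega]
        ring

/-- The polynomial `hitGen` evaluated at `x`, in terms of `rookRec`. -/
noncomputable def hitEval (c : ℕ → ℕ) (n : ℕ) (x : R) : R :=
  ∑ j ∈ Finset.range (n + 1),
    qfact q j * rookRec q c n (n - j) * ∏ i ∈ Finset.Icc (j + 1) n, (x - q ^ i)

lemma hitEval_congr {c d : ℕ → ℕ} {n : ℕ} (h : ∀ j < n, c j = d j) (x : R) :
    hitEval q c n x = hitEval q d n x := by
  simp only [hitEval, rookRec_congr q h]

lemma hitEval_deletion_contraction {c : ℕ → ℕ} {n p : ℕ} (hp : p < n + 1)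
    (h0 : 0 < c p) (hl : ∀ j < p, c j < c p) (x : R) :
    hitEval q c (n + 1) x = q * hitEval q (lowerCol c p) (n + 1) x +
      (x - q ^ (n + 1)) * hitEval q (contractCol c p) n x := by
  simp only [hitEval]
  rw [Finset.sum_range_succ, Finset.sum_range_succ _ (n + 1), mul_add, Finset.mul_sum,
    Finset.mul_sum, add_right_comm (∑ i ∈ _, _), ← Finset.sum_add_distrib]
  congr 1
  · refine Finset.sum_congr rfl fun j hj => ?_
    have hj' : j ≤ n := by simpa [Nat.lt_succ_iff] using hj
    rw [show n + 1 - j = (n - j) + 1 by omega, rookRec_succ_lowerCol q hp h0 hl,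
      Finset.prod_Icc_succ_top (by omega)]
    ring
  · rw [Nat.sub_self, rookRec_zero_lowerCol q hp h0]
    ring

lemma rookRec_zero_board (n : ℕ) : rookRec q (fun _ => 0) n 0 = 1 := by
  induction n with
  | zero => simp [rookRec]
  | succ n ih => simp [rookRec, ih]

lemma hitEval_zero_board (n : ℕ) (x : R) : hitEval q (fun _ => 0) n x = qfact q n := by
  rw [hitEval, Finset.sum_range_succ, Finset.sum_eq_zero]
  · simp [rookRec_zero_board]
  · intro j hj
    rw [rookRec_eq_zero q (by simp at hj; omega) (by simp at hj; omega)]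
    simp

lemma hitEval_rectangle {a n : ℕ} (h : a ≤ n) (x : R) :
    hitEval q (fun _ => a) n x = qfact q n * x ^ a := by
  induction a generalizing n with
  | zero => simp [hitEval_zero_board]
  | succ a ih =>
    cases n with
    | zero => omega
    | succ n =>
      have key (p : ℕ) (hp : p ≤ n + 1) : hitEval q (fun _ => a + 1) (n + 1) x =
          q ^ p * hitEval q (fun j => if j < p then a else a + 1) (n + 1) x +
            qint q p * ((x - q ^ (n + 1)) * hitEval q (fun _ => a) n x) := by
        induction p with
        | zero => simp [qint_zero]
        | succ p ihp =>
          rw [ihp (by omega), hitEval_deletion_contraction q (p := p)]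
          · rw [hitEval_congr q (c := lowerCol _ p) (d := fun j => if j < p + 1 then a else a + 1),
              hitEval_congr q (c := contractCol _ p) (d := fun _ => a), qint_add]
            · simp only [qint_succ q 0, qint_zero]
              ring
            · intro j _
              simp only [contractCol]
              split_ifs <;> omega
            · intro j _
              simp only [lowerCol]
              split_ifs <;> omega
          · omega
          · simp
          · intro j hj
            simp [hj]
      rw [key (n + 1) le_rfl, hitEval_congr q (d := fun _ => a) (by intro j hj; simp [hj]),
        ih (by omega), ih (by omega), qfact_succ]
      ring

end RookRec

section ColumnRecursion

variable {K : Type*} [Field K] (q : K)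

/-- The number of squares in row `i` and in columns `1, …, n`. -/
def rowTail (c : ℕ → ℕ) (n i : ℕ) : ℕ := ∑ j : Fin n, if i < c (j + 1) then 1 else 0

/-- The factor contributed by a rook in row `i` of column `0` of a board in the
`(n + 1) × (n + 1)` grid. -/
def rowWeight (c : ℕ → ℕ) (n i : ℕ) (x : K) : K :=
  if i < c 0 then x * q ^ (n + (c 0 - 1 - i)) else q ^ (i + rowTail c n i)

lemma val_succAbove {n : ℕ} (r : Fin (n + 1)) (i : Fin n) :
    (r.succAbove i : ℕ) = if (i : ℕ) < r then (i : ℕ) else i + 1 := by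
  simp only [Fin.succAbove, Fin.lt_def, Fin.val_castSucc]
  split_ifs <;> simp

lemma rowTail_lowerCol_of_ne {c : ℕ → ℕ} {n i p : ℕ} (hi : i ≠ c (p + 1) - 1) :
    rowTail (lowerCol c (p + 1)) n i = rowTail c n i := by
  refine Finset.sum_congr rfl fun j _ => ?_
  simp only [lowerCol, Nat.add_right_cancel_iff]
  split_ifs with h <;> first | rfl | (subst h; omega)

lemma rowTail_lowerCol_self {c : ℕ → ℕ} {n p : ℕ} (hp : p < n) (h0 : 0 < c (p + 1)) :
    rowTail c n (c (p + 1) - 1) = rowTail (lowerCol c (p + 1)) n (c (p + 1) - 1) + 1 := by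
  obtain ⟨n, rfl⟩ := Nat.exists_eq_succ_of_ne_zero (by omega : n ≠ 0)
  rw [rowTail, rowTail, Fin.sum_univ_succAbove _ ⟨p, hp⟩, Fin.sum_univ_succAbove _ ⟨p, hp⟩]
  have : ∀ j : Fin n, ((⟨p, hp⟩ : Fin (n + 1)).succAbove j : ℕ) ≠ p := fun j h =>
    Fin.succAbove_ne ⟨p, hp⟩ j (Fin.ext h)
  simp [lowerCol, this, h0, add_comm 1]

lemma rowTail_contractCol {c : ℕ → ℕ} (hc : Monotone c) {n p i : ℕ} (hp : p < n + 1)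
    (hlt : c p < c (p + 1)) :
    rowTail c (n + 1) (if i < c (p + 1) - 1 then i else i + 1) =
      rowTail (contractCol c (p + 1)) n i + if i < c (p + 1) - 1 then 1 else 0 := by
  rw [rowTail, rowTail, Fin.sum_univ_succAbove _ ⟨p, hp⟩, add_comm]
  congr 1
  · refine Finset.sum_congr rfl fun j _ => ?_
    rw [val_succAbove]
    simp only [contractCol]
    by_cases hj : (j : ℕ) < p
    · have : c (j + 1) ≤ c p := hc (by omega)
      simp only [hj, if_true, if_pos (show (j : ℕ) + 1 < p + 1 by omega)]
      split_ifs <;> omega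
    · have : c (p + 1) ≤ c (j + 1 + 1) := hc (by omega)
      simp only [hj, if_false, if_neg (show ¬ (j : ℕ) + 1 < p + 1 by omega)]
      split_ifs <;> omega
  · simp only
    split_ifs <;> omega

lemma deleteRow_lowerCol_self {c : ℕ → ℕ} {p : ℕ} :
    deleteRow (lowerCol c (p + 1)) (c (p + 1) - 1) = deleteRow c (c (p + 1) - 1) := by
  funext j
  simp only [deleteRow, lowerCol, Nat.add_right_cancel_iff]
  by_cases h : j = p
  · subst h; simp only [if_true]; split_ifs <;> omega
  · simp [h]

lemma lowerCol_deleteRow {c : ℕ → ℕ} {p i : ℕ} (hi : i ≠ c (p + 1) - 1) :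
    lowerCol (deleteRow c i) p = deleteRow (lowerCol c (p + 1)) i := by
  funext j
  simp only [deleteRow, lowerCol, Nat.add_right_cancel_iff]
  by_cases h : j = p
  · subst h; simp only [if_true]; split_ifs <;> omega
  · simp [h]

lemma contractCol_deleteRow {c : ℕ → ℕ} (hc : Monotone c) {p i : ℕ}
    (hlt : c p < c (p + 1)) :
    contractCol (deleteRow c (if i < c (p + 1) - 1 then i else i + 1)) p =
      deleteRow (contractCol c (p + 1)) i := by
  funext j
  simp only [deleteRow, contractCol, Nat.add_lt_add_iff_right]
  by_cases hj : j < p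
  · have : c (j + 1) ≤ c p := hc (by omega)
    simp only [hj, if_true]
    split_ifs <;> omega
  · have : c (p + 1) ≤ c (j + 1 + 1) := hc (by omega)
    simp only [hj, if_false]
    split_ifs <;> omega

lemma monotone_lowerCol {c : ℕ → ℕ} (hc : Monotone c) {p : ℕ} (hlt : c p < c (p + 1)) :
    Monotone (lowerCol c (p + 1)) := by
  intro a b hab
  have h1 := hc hab
  simp only [lowerCol]
  split_ifs with ha hb hb
  · rfl
  · subst ha; omega
  · subst hb; have := hc (show a ≤ p by omega); omega
  · exact h1

lemma monotone_contractCol {c : ℕ → ℕ} (hc : Monotone c) {p : ℕ} (hlt : c p < c (p + 1)) :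
    Monotone (contractCol c (p + 1)) := by
  intro a b hab
  simp only [contractCol]
  split_ifs with ha hb hb
  · exact hc hab
  · have := hc (show a ≤ p by omega)
    have := hc (show p + 1 ≤ b + 1 by omega)
    omega
  · omega
  · have := hc (show a + 1 ≤ b + 1 by omega)
    omega

lemma monotone_deleteRow {c : ℕ → ℕ} (hc : Monotone c) (i : ℕ) : Monotone (deleteRow c i) := by
  intro a b hab
  have := hc (show a + 1 ≤ b + 1 by omega)
  simp only [deleteRow]
  split_ifs <;> omega

variable {q}

lemma hitEval_column_rectangle (hq : q ≠ 0) {c : ℕ → ℕ} {n : ℕ} (ha : c 0 ≤ n + 1)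
    (h : ∀ j < n + 1, c j = c 0) (x : K) :
    hitEval q c (n + 1) x =
      ∑ i : Fin (n + 1), rowWeight q c n i x * hitEval q (deleteRow c i) n (x / q) := by
  set a := c 0 with hadef
  obtain ⟨b, hb⟩ := Nat.exists_eq_add_of_le ha
  have hdel (i : ℕ) (hi : i < n + 1) : hitEval q (deleteRow c i) n (x / q) =
      qfact q n * (x / q) ^ (a - if i < a then 1 else 0) := by
    rw [hitEval_congr q (d := fun _ => a - if i < a then 1 else 0), hitEval_rectangle]
    · split_ifs <;> omega
    · intro j hj
      simp only [deleteRow, h (j + 1) (by omega)]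
  rw [hitEval_congr q (d := fun _ => a) h, hitEval_rectangle q ha,
    Fin.sum_univ_eq_sum_range
      (fun i => rowWeight q c n i x * hitEval q (deleteRow c i) n (x / q)) (n + 1),
    Finset.sum_congr rfl (fun i hi => by rw [hdel i (Finset.mem_range.1 hi)]), hb,
    Finset.sum_range_add]
  have h1 : ∑ i ∈ Finset.range a, rowWeight q c n i x *
      (qfact q n * (x / q) ^ (a - if i < a then 1 else 0)) =
      qfact q n * x ^ a * (q ^ b * qint q a) := by
    rw [qint, ← Finset.sum_range_reflect (fun i => q ^ i), Finset.mul_sum, Finset.mul_sum]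
    refine Finset.sum_congr rfl fun i hi => ?_
    have hi := Finset.mem_range.1 hi
    obtain ⟨a', ha'⟩ := Nat.exists_eq_succ_of_ne_zero (by omega : a ≠ 0)
    have hn : n = a' + b := by omega
    rw [rowWeight, ← hadef, if_pos hi, if_pos hi, ha', hn, div_pow]
    simp only [Nat.succ_eq_add_one, Nat.add_sub_cancel]
    field_simp
    ring
  have h2 : ∑ i ∈ Finset.range b, rowWeight q c n (a + i) x *
      (qfact q n * (x / q) ^ (a - if a + i < a then 1 else 0)) =
      qfact q n * x ^ a * qint q b := by
    rw [qint, Finset.mul_sum]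
    refine Finset.sum_congr rfl fun i hi => ?_
    have ht : rowTail c n (a + i) = 0 := by
      refine Finset.sum_eq_zero fun j _ => ?_
      rw [h _ (by omega)]
      simp
    rw [rowWeight, ← hadef, if_neg (by omega), if_neg (by omega), ht, div_pow]
    simp only [add_zero, Nat.sub_zero]
    field_simp
    ring
  rw [h1, h2, ← hb, qfact_succ, hb, add_comm a b, qint_add]
  ring

/-- Expansion of the `q`-hit polynomial along the row of the rook in column `0`. -/
theorem hitEval_column (hq : q ≠ 0) {n : ℕ} {c : ℕ → ℕ} (hc : Monotone c)
    (hn : ∀ j, c j ≤ n + 1) (x : K) :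
    hitEval q c (n + 1) x =
      ∑ i : Fin (n + 1), rowWeight q c n i x * hitEval q (deleteRow c i) n (x / q) := by
  induction n generalizing c with
  | zero =>
    refine hitEval_column_rectangle hq (hn 0) (fun j hj => ?_) x
    rw [show j = 0 by omega]
  | succ m ihm =>
    obtain ⟨s, hs⟩ : ∃ s, s = ∑ j ∈ Finset.range (m + 2), c j := ⟨_, rfl⟩
    induction s using Nat.strong_induction_on generalizing c with
    | _ s ihs =>
    by_cases hcor : ∃ p < m + 1, c p < c (p + 1)
    · obtain ⟨p, hp, hlt⟩ := hcor
      have hr : c (p + 1) - 1 < m + 2 := by have := hn (p + 1); omega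
      let r : Fin (m + 2) := ⟨c (p + 1) - 1, hr⟩
      have hlow := ihs _ (by
          rw [hs]
          refine Finset.sum_lt_sum (fun j _ => ?_) ⟨p + 1, by simpa using hp, ?_⟩
          · simp only [lowerCol]; split_ifs with h
            · subst h; omega
            · rfl
          · simp only [lowerCol, if_true]; omega)
        (monotone_lowerCol hc hlt) (fun j => by
          have := hn j; have := hn (p + 1); simp only [lowerCol]; split_ifs <;> omega) rfl
      have hcon := ihm (monotone_contractCol hc hlt) (fun j => by
          simp only [contractCol]
          split_ifs with h
          · have := hc (show j ≤ p by omega); have := hn (p + 1); omega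
          · have := hn (j + 1); omega)
      rw [hitEval_deletion_contraction q (p := p + 1) (by omega) (by omega)
        (fun j hj => (hc (show j ≤ p by omega)).trans_lt hlt), hlow, hcon,
        Fin.sum_univ_succAbove _ r, Fin.sum_univ_succAbove _ r, mul_add, add_assoc,
        Finset.mul_sum, Finset.mul_sum, ← Finset.sum_add_distrib]
      have h0r : ¬ c (p + 1) - 1 < c 0 := by have := hc (Nat.zero_le p); omega
      have hL0 : lowerCol c (p + 1) 0 = c 0 := by simp [lowerCol]
      have hC0 : contractCol c (p + 1) 0 = c 0 := by simp [contractCol]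
      congr 1
      · simp only [r, deleteRow_lowerCol_self, rowWeight, hL0, if_neg h0r,
          rowTail_lowerCol_self hp (show 0 < c (p + 1) by omega)]
        ring
      · refine Finset.sum_congr rfl fun i _ => ?_
        have hi : (r.succAbove i : ℕ) = if (i : ℕ) < c (p + 1) - 1 then (i : ℕ) else i + 1 :=
          val_succAbove r i
        have hir : (r.succAbove i : ℕ) ≠ c (p + 1) - 1 := by rw [hi]; split_ifs <;> omega
        have hw : rowWeight q (lowerCol c (p + 1)) (m + 1) (r.succAbove i) x =
            rowWeight q c (m + 1) (r.succAbove i) x := by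
          simp only [rowWeight, hL0, rowTail_lowerCol_of_ne hir]
        have hw' : rowWeight q c (m + 1) (r.succAbove i) x =
            q * rowWeight q (contractCol c (p + 1)) m i x := by
          simp only [rowWeight, hC0, hi, rowTail_contractCol hc hp hlt]
          have := hc (Nat.zero_le p)
          split_ifs <;> first | omega | ring
        rw [hw, hitEval_deletion_contraction q (c := deleteRow c _) hp, lowerCol_deleteRow hir,
          hw', hi, contractCol_deleteRow hc hlt]
        · field_simp
          ring
        · simp only [deleteRow]; split_ifs <;> omega
        · intro j hj
          have : c (j + 1) ≤ c p := hc (by omega)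
          simp only [deleteRow]; split_ifs <;> omega
    · push Not at hcor
      refine hitEval_column_rectangle hq (hn 0) (fun j hj => ?_) x
      induction j with
      | zero => rfl
      | succ j ih => exact (le_antisymm (hcor j (by omega)) (hc (by omega))).trans (ih (by omega))

end ColumnRecursion

section PermutationSum

/-- The permutation with `0 ↦ i` and `j.succ ↦ i.succAbove (τ j)`. -/
def insertPerm {n : ℕ} (i : Fin (n + 1)) (τ : Equiv.Perm (Fin n)) : Equiv.Perm (Fin (n + 1)) :=
  (finSuccEquiv n).trans ((Equiv.optionCongr τ).trans (finSuccEquiv' i).symm)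

lemma insertPerm_zero {n : ℕ} (i : Fin (n + 1)) (τ : Equiv.Perm (Fin n)) :
    insertPerm i τ 0 = i := by
  simp [insertPerm]

lemma insertPerm_succ {n : ℕ} (i : Fin (n + 1)) (τ : Equiv.Perm (Fin n)) (j : Fin n) :
    insertPerm i τ j.succ = i.succAbove (τ j) := by
  simp [insertPerm]

lemma insertPerm_bijective (n : ℕ) :
    Function.Bijective fun p : Fin (n + 1) × Equiv.Perm (Fin n) => insertPerm p.1 p.2 := by
  rw [Fintype.bijective_iff_injective_and_card]
  refine ⟨?_, by simp [Fintype.card_perm, Nat.factorial_succ]⟩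
  rintro ⟨i, τ⟩ ⟨i', τ'⟩ h
  have h0 := congrArg (fun σ => σ 0) h
  simp only [insertPerm_zero] at h0
  subst h0
  have hτ : τ = τ' := by
    ext1 j
    have hj := congrArg (fun σ => σ j.succ) h
    simp only [insertPerm_succ] at hj
    exact Fin.succAbove_right_injective hj
  rw [hτ]

/-- Starting below the last square of a column of height `h`, going down to the bottom of the grid
and then up from the last square of the board, row `a` is met before row `b`. -/
def MetBefore (h a b : ℕ) : Prop := if b < h then b < a else h ≤ a ∧ a < b

/-- The number of rooks on the board. -/
noncomputable def onBoard (c : ℕ → ℕ) {n : ℕ} (σ : Equiv.Perm (Fin n)) : ℕ :=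
  ∑ j : Fin n, if (σ j : ℕ) < c j then 1 else 0

/-- The number of squares not counted by `crossStat`. -/
noncomputable def uncrossed (c : ℕ → ℕ) {n : ℕ} (σ : Equiv.Perm (Fin n)) : ℕ :=
  ∑ j : Fin n, ∑ j' : Fin n, if j < j' ∧ MetBefore (c j) (σ j') (σ j) then 1 else 0

lemma succAbove_lt_iff_deleteRow {n : ℕ} (c : ℕ → ℕ) (i : Fin (n + 1)) (a : Fin n) (j : ℕ) :
    (i.succAbove a : ℕ) < c (j + 1) ↔ (a : ℕ) < deleteRow c i j := by
  rw [val_succAbove, deleteRow]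
  split_ifs <;> omega

lemma metBefore_succAbove {n : ℕ} (c : ℕ → ℕ) (i : Fin (n + 1)) (a b : Fin n) (j : ℕ) :
    MetBefore (c (j + 1)) (i.succAbove a) (i.succAbove b) ↔ MetBefore (deleteRow c i j) a b := by
  simp only [MetBefore, succAbove_lt_iff_deleteRow, ← not_lt (b := c (j + 1)),
    ← not_lt (b := deleteRow c i j), ← Fin.lt_def, (Fin.strictMono_succAbove i).lt_iff_lt]

lemma onBoard_insertPerm (c : ℕ → ℕ) {n : ℕ} (i : Fin (n + 1)) (τ : Equiv.Perm (Fin n)) :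
    onBoard c (insertPerm i τ) =
      (if (i : ℕ) < c 0 then 1 else 0) + onBoard (deleteRow c i) τ := by
  simp only [onBoard, Fin.sum_univ_succ, insertPerm_zero, insertPerm_succ, Fin.val_zero,
    Fin.val_succ, succAbove_lt_iff_deleteRow]

lemma sum_metBefore (h : ℕ) {n : ℕ} (i : Fin (n + 1)) :
    (∑ a : Fin n, if MetBefore h (i.succAbove a) i then 1 else 0) =
      if (i : ℕ) < h then n - i else i - h := by
  have h1 : (∑ a : Fin (n + 1), if MetBefore h a i then 1 else 0) =
      ∑ a : Fin n, if MetBefore h (i.succAbove a) i then 1 else 0 := by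
    rw [Fin.sum_univ_succAbove _ i]
    simp [MetBefore]
  rw [← h1, Fin.sum_univ_eq_sum_range (fun a => if MetBefore h a i then 1 else 0) (n + 1),
    ← Finset.card_filter]
  have hi := i.isLt
  split_ifs with hh
  · have : (Finset.range (n + 1)).filter (fun a => MetBefore h a i) = Finset.Ioc (i : ℕ) n := by
      ext a
      simp only [Finset.mem_filter, Finset.mem_range, MetBefore, if_pos hh, Finset.mem_Ioc]
      omega
    rw [this, Nat.card_Ioc]
  · have : (Finset.range (n + 1)).filter (fun a => MetBefore h a i) = Finset.Ico h (i : ℕ) := by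
      ext a
      simp only [Finset.mem_filter, Finset.mem_range, MetBefore, if_neg hh, Finset.mem_Ico]
      omega
    rw [this, Nat.card_Ico]

lemma uncrossed_insertPerm (c : ℕ → ℕ) {n : ℕ} (i : Fin (n + 1)) (τ : Equiv.Perm (Fin n)) :
    uncrossed c (insertPerm i τ) =
      (if (i : ℕ) < c 0 then n - i else i - c 0) + uncrossed (deleteRow c i) τ := by
  rw [← sum_metBefore, ← Equiv.sum_comp τ]
  simp only [uncrossed, Fin.sum_univ_succ, insertPerm_zero, insertPerm_succ, Fin.val_zero,
    Fin.val_succ, metBefore_succAbove, Fin.succ_pos, Fin.succ_lt_succ_iff, false_and,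
    true_and, if_false, zero_add, not_lt_zero]

lemma area_deleteRow (c : ℕ → ℕ) (n i : ℕ) :
    ∑ j : Fin (n + 1), c j = c 0 + rowTail c n i + ∑ j : Fin n, deleteRow c i j := by
  rw [Fin.sum_univ_succ, rowTail, add_assoc, ← Finset.sum_add_distrib]
  congr 1
  refine Finset.sum_congr rfl fun j _ => ?_
  simp only [deleteRow, Fin.val_succ]
  split_ifs <;> omega

variable {K : Type*} [Field K] {q : K}

/-- The `q`-hit polynomial as a sum over permutations. -/
theorem hitEval_eq_sum_perm (hq : q ≠ 0) {n : ℕ} {c : ℕ → ℕ} (hc : Monotone c)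
    (hn : ∀ j, c j ≤ n) (x : K) :
    hitEval q c n x = ∑ σ : Equiv.Perm (Fin n), x ^ onBoard c σ *
      q ^ ((uncrossed c σ : ℤ) + ((∑ j : Fin n, c j : ℕ) : ℤ) - n * onBoard c σ) := by
  induction n generalizing c x with
  | zero => simp [hitEval, qfact, rookRec, onBoard, uncrossed]
  | succ n ih =>
    rw [hitEval_column hq hc hn, ← (insertPerm_bijective n).sum_comp, Fintype.sum_prod_type]
    refine Finset.sum_congr rfl fun i _ => ?_
    have hdn (j) : deleteRow c i j ≤ n := by
      have := hn (j + 1)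
      have := i.isLt
      simp only [deleteRow]
      split_ifs <;> omega
    rw [ih (monotone_deleteRow hc i) hdn, Finset.mul_sum]
    refine Finset.sum_congr rfl fun τ _ => ?_
    rw [onBoard_insertPerm, uncrossed_insertPerm, area_deleteRow c n i, div_pow, rowWeight]
    set o := onBoard (deleteRow c i) τ
    set u := uncrossed (deleteRow c i) τ
    set A := ∑ j : Fin n, deleteRow c i j
    have hi := i.isLt
    split_ifs with h
    · have ht : rowTail c n i = n := by
        have (j : Fin n) : (i : ℕ) < c (j + 1) := h.trans_le (hc (Nat.zero_le _))
        simp [rowTail, this]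
      have e : (((n - i + u : ℕ) : ℤ) + ((c 0 + rowTail c n i + A : ℕ) : ℤ) -
          (n + 1 : ℕ) * ((1 + o : ℕ) : ℤ)) =
          ((n + (c 0 - 1 - i) : ℕ) : ℤ) - (o : ℤ) + ((u : ℤ) + (A : ℤ) - n * o) := by
        rw [ht]
        push_cast [Nat.cast_sub (show (i : ℕ) ≤ n by omega), Nat.sub_sub,
          Nat.cast_sub (show 1 + (i : ℕ) ≤ c 0 by omega)]
        ring
      rw [e, zpow_add₀ hq, zpow_sub₀ hq _ (o : ℤ), zpow_natCast, zpow_natCast, pow_add x]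
      ring
    · have e : (((i - c 0 + u : ℕ) : ℤ) + ((c 0 + rowTail c n i + A : ℕ) : ℤ) -
          (n + 1 : ℕ) * ((0 + o : ℕ) : ℤ)) =
          ((i + rowTail c n i : ℕ) : ℤ) - (o : ℤ) + ((u : ℤ) + (A : ℤ) - n * o) := by
        push_cast [Nat.cast_sub (show c 0 ≤ (i : ℕ) by omega)]
        ring
      rw [e, zpow_add₀ hq, zpow_sub₀ hq _ (o : ℤ), zpow_natCast, zpow_natCast, zero_add]
      ring

end PermutationSum

section FullPlacements

/-- The placement with a rook in row `σ j` of each column `j`. -/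
def rooksOf {n : ℕ} (σ : Equiv.Perm (Fin n)) : Finset (Fin n × Fin n) :=
  Finset.univ.map ⟨fun j => (σ j, j), fun _ _ h => (Prod.ext_iff.1 h).2⟩

lemma mem_rooksOf {n : ℕ} {σ : Equiv.Perm (Fin n)} {s : Fin n × Fin n} :
    s ∈ rooksOf σ ↔ σ s.2 = s.1 := by
  simp only [rooksOf, Finset.mem_map, Finset.mem_univ, true_and]
  constructor
  · rintro ⟨j, rfl⟩; rfl
  · intro h; exact ⟨s.2, Prod.ext h rfl⟩

lemma rooksOf_injective (n : ℕ) : Function.Injective (rooksOf (n := n)) := by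
  intro σ τ h
  ext1 j
  have : (σ j, j) ∈ rooksOf τ := h ▸ mem_rooksOf.2 rfl
  exact (mem_rooksOf.1 this).symm

lemma card_rooksOf {n : ℕ} (σ : Equiv.Perm (Fin n)) : (rooksOf σ).card = n := by
  simp [rooksOf]

lemma nonAttacking_rooksOf {n : ℕ} (σ : Equiv.Perm (Fin n)) : NonAttacking (rooksOf σ) := by
  intro r hr r' hr' hne
  rw [mem_rooksOf] at hr hr'
  have h2 : r.2 ≠ r'.2 := fun h => hne (Prod.ext (by rw [← hr, ← hr', h]) h)
  exact ⟨fun h => h2 (σ.injective (by rw [hr, hr', h])), h2⟩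

lemma exists_eq_rooksOf {n : ℕ} {C : Finset (Fin n × Fin n)} (hC : C.card = n)
    (h : NonAttacking C) : ∃ σ, rooksOf σ = C := by
  have hinj : Set.InjOn Prod.snd (C : Set (Fin n × Fin n)) := fun r hr r' hr' e => by
    by_contra hne
    exact (h r hr r' hr' hne).2 e
  have himg : C.image Prod.snd = Finset.univ :=
    Finset.eq_univ_of_card _ (by rw [Finset.card_image_of_injOn hinj, hC, Fintype.card_fin])
  have hex (j : Fin n) : ∃ i, (i, j) ∈ C := by
    have hj : j ∈ C.image Prod.snd := himg ▸ Finset.mem_univ j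
    obtain ⟨⟨i, _⟩, hr, rfl⟩ := Finset.mem_image.1 hj
    exact ⟨i, hr⟩
  choose f hf using hex
  have hfinj : Function.Injective f := fun j j' e => by
    by_contra hne
    exact (h _ (hf j) _ (hf j') (fun e' => hne (Prod.ext_iff.1 e').2)).1 e
  refine ⟨Equiv.ofBijective f (Finite.injective_iff_bijective.1 hfinj),
    Finset.eq_of_subset_of_card_le (fun s hs => ?_) (by rw [hC, card_rooksOf])⟩
  have := mem_rooksOf.1 hs
  rw [Equiv.ofBijective_apply] at this
  have h2 := hf s.2
  rwa [this] at h2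

lemma card_rooksOf_inter (c : ℕ → ℕ) {n : ℕ} (σ : Equiv.Perm (Fin n)) :
    (rooksOf σ ∩ boardSq n fun j => c j).card = onBoard c σ := by
  rw [onBoard, ← Finset.card_filter, boardSq, Finset.inter_filter, Finset.inter_univ, rooksOf,
    Finset.filter_map, Finset.card_map]
  rfl

lemma sum_fullPlacements {M : Type*} [AddCommMonoid M] (c : ℕ → ℕ) (n k : ℕ)
    (f : Finset (Fin n × Fin n) → M) :
    ∑ C ∈ fullPlacements n (fun j => c j) k, f C =
      ∑ σ : Equiv.Perm (Fin n) with onBoard c σ = k, f (rooksOf σ) := by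
  symm
  refine Finset.sum_nbij rooksOf ?_ (rooksOf_injective n).injOn ?_ fun _ _ => rfl
  · intro σ hσ
    simp only [fullPlacements, Finset.mem_filter, Finset.mem_univ, true_and] at hσ ⊢
    exact ⟨card_rooksOf σ, nonAttacking_rooksOf σ, by rw [card_rooksOf_inter, hσ]⟩
  · intro C hC
    simp only [fullPlacements, Finset.coe_filter, Finset.mem_univ, true_and,
      Set.mem_ofPred_eq] at hC
    obtain ⟨σ, rfl⟩ := exists_eq_rooksOf hC.1 hC.2.1
    exact ⟨σ, by simpa [card_rooksOf_inter] using hC.2.2, rfl⟩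

lemma crossStat_add_uncrossed (c : ℕ → ℕ) {n : ℕ} (σ : Equiv.Perm (Fin n)) :
    crossStat n (fun j => c j) (rooksOf σ) + uncrossed c σ = n * n := by
  have hcard : Fintype.card (Fin n × Fin n) = n * n := by simp
  rw [← hcard, ← Finset.card_univ, crossStat]
  refine (congrArg (_ + ·) ?_).trans (Finset.card_filter_add_card_filter_not _)
  rw [uncrossed, Finset.card_filter, Fintype.sum_prod_type_right]
  refine Finset.sum_congr rfl fun j _ => ?_
  refine Eq.trans ?_ (Equiv.sum_comp σ _)
  refine Finset.sum_congr rfl fun j' _ => if_congr ?_ rfl rfl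
  have h1 : (∃ r ∈ rooksOf σ, r.1 = σ j' ∧ r.2 < j) ↔ j' < j := by
    constructor
    · rintro ⟨r, hr, e, hlt⟩
      rw [mem_rooksOf, e] at hr
      rwa [← σ.injective hr]
    · exact fun h => ⟨(σ j', j'), mem_rooksOf.2 rfl, rfl, h⟩
  have h2 : (∃ r ∈ rooksOf σ, r.2 = j ∧ σ j' < r.1) ↔ σ j' < σ j := by
    constructor
    · rintro ⟨r, hr, rfl, hlt⟩
      rwa [mem_rooksOf.1 hr]
    · exact fun h => ⟨(σ j, j), mem_rooksOf.2 rfl, rfl, h⟩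
  have h3 : (∃ r ∈ rooksOf σ, r ∉ (boardSq n fun j => c j) ∧ r.2 = j ∧ r.1 < σ j') ↔
      ¬ (σ j : ℕ) < c j ∧ σ j < σ j' := by
    constructor
    · rintro ⟨r, hr, hb, rfl, hlt⟩
      rw [mem_rooksOf.1 hr]
      exact ⟨by simpa [boardSq] using hb, hlt⟩
    · exact fun h => ⟨(σ j, j), mem_rooksOf.2 rfl, by simpa [boardSq] using h.1, rfl, h.2⟩
  simp only [h1, h2, h3]
  have h4 : (σ j', j) ∈ (boardSq n fun j => c j) ↔ (σ j' : ℕ) < c j := by simp [boardSq]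
  have h5 : (σ j', j) ∈ rooksOf σ ↔ j = j' := by
    rw [mem_rooksOf]; exact σ.injective.eq_iff
  rw [h4, h5, MetBefore]
  have h6 : j ≠ j' → (σ j : ℕ) ≠ σ j' := fun h e => h (σ.injective (Fin.ext e))
  clear h1 h2 h3 h4 h5 hcard
  simp only [Fin.lt_def, ne_eq, Fin.ext_iff] at h6 ⊢
  generalize (σ j : ℕ) = a at h6 ⊢
  generalize (σ j' : ℕ) = b at h6 ⊢
  split_ifs <;> omega

end FullPlacements

section RookPlacements

variable {R : Type*} [CommRing R] (q : R)

/-- The board consisting of the columns `0, …, t - 1`. -/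
def truncBoard (c : ℕ → ℕ) (n t : ℕ) : Fin n → ℕ := fun j => if (j : ℕ) < t then c j else 0

/-- The rows of column `t` of the board that contain no rook of `C`. -/
noncomputable def openRows (c : ℕ → ℕ) {n : ℕ} (t : ℕ) (C : Finset (Fin n × Fin n)) :
    Finset (Fin n) :=
  Finset.univ.filter fun i => (i : ℕ) < c t ∧ ∀ r ∈ C, r.1 ≠ i

lemma mem_boardSq_truncBoard {c : ℕ → ℕ} {n t : ℕ} {s : Fin n × Fin n} :
    s ∈ boardSq n (truncBoard c n t) ↔ (s.2 : ℕ) < t ∧ (s.1 : ℕ) < c s.2 := by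
  rw [boardSq, Finset.mem_filter, truncBoard]
  split_ifs <;> simp_all

lemma sum_pow_card_filter_lt {α : Type*} [LinearOrder α] (S : Finset α) :
    ∑ i ∈ S, q ^ (S.filter fun a => i < a).card = qint q S.card := by
  induction S using Finset.induction_on_min with
  | empty => simp [qint]
  | insert a S ha ih =>
    have hS : a ∉ S := fun h => lt_irrefl a (ha a h)
    have h1 : (insert a S).filter (fun b => a < b) = S := by
      ext b
      simp only [Finset.mem_filter, Finset.mem_insert]
      constructor
      · rintro ⟨rfl | h, h'⟩
        · exact absurd h' (lt_irrefl _)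
        · exact h
      · exact fun h => ⟨Or.inr h, ha b h⟩
    have h2 : ∀ i ∈ S, (insert a S).filter (fun b => i < b) = S.filter fun b => i < b := by
      intro i hi
      rw [Finset.filter_insert, if_neg (ha i hi).not_gt]
    rw [Finset.sum_insert hS, h1, Finset.sum_congr rfl fun i hi => by rw [h2 i hi], ih,
      Finset.card_insert_of_notMem hS, qint, qint, Finset.sum_range_succ, add_comm]

lemma card_openRows {c : ℕ → ℕ} (hc : Monotone c) {n : ℕ} {t k : ℕ} (hn : c t ≤ n)
    {C : Finset (Fin n × Fin n)} (hC : C ∈ placements n (truncBoard c n t) k) :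
    (openRows c t C).card = c t - k := by
  simp only [placements, Finset.mem_filter, Finset.mem_univ, true_and] at hC
  obtain ⟨hk, hb, ha⟩ := hC
  have hinj : Set.InjOn Prod.fst (C : Set (Fin n × Fin n)) := fun r hr r' hr' e => by
    by_contra hne
    exact (ha r hr r' hr' hne).1 e
  have hsub : C.image Prod.fst ⊆ Finset.univ.filter fun i : Fin n => (i : ℕ) < c t := by
    intro i hi
    obtain ⟨r, hr, rfl⟩ := Finset.mem_image.1 hi
    have := mem_boardSq_truncBoard.1 (hb hr)
    simpa using this.2.trans_le (hc this.1.le)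
  have heq : openRows c t C =
      (Finset.univ.filter fun i : Fin n => (i : ℕ) < c t) \ C.image Prod.fst := by
    ext i
    simp only [openRows, Finset.mem_filter, Finset.mem_univ, true_and, Finset.mem_sdiff,
      Finset.mem_image, not_exists, not_and]
  rw [heq, Finset.card_sdiff_of_subset hsub, Finset.card_image_of_injOn hinj, hk,
    Fin.card_filter_val_lt, min_eq_right hn]

lemma rookInv_truncBoard_succ (c : ℕ → ℕ) {n t : ℕ} (ht : t < n) (D : Finset (Fin n × Fin n)) :
    rookInv n (truncBoard c n (t + 1)) D =
      rookInv n (truncBoard c n t) (D.filter fun r => (r.2 : ℕ) < t) +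
        (Finset.univ.filter fun i : Fin n => (i : ℕ) < c t ∧ (i, (⟨t, ht⟩ : Fin n)) ∉ D ∧
          ∀ r ∈ D, ¬(r.2 = ⟨t, ht⟩ ∧ i < r.1) ∧ ¬(r.1 = i ∧ r.2 < ⟨t, ht⟩)).card := by
  rw [rookInv, ← Finset.card_filter_add_card_filter_not
    (fun s : Fin n × Fin n => (s.2 : ℕ) < t)]
  congr 1
  · rw [rookInv]
    congr 1
    ext s
    simp only [Finset.mem_filter, mem_boardSq_truncBoard]
    constructor
    · rintro ⟨⟨⟨_, hs⟩, hD, h⟩, hst⟩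
      exact ⟨⟨hst, hs⟩, fun h' => hD h'.1, fun r hr => h r hr.1⟩
    · rintro ⟨⟨hst, hs⟩, hD, h⟩
      refine ⟨⟨⟨by omega, hs⟩, fun h' => hD ⟨h', hst⟩, fun r hr => ?_⟩, hst⟩
      by_cases hrt : (r.2 : ℕ) < t
      · exact h r ⟨hr, hrt⟩
      · refine ⟨fun h' => hrt (h'.1 ▸ hst), fun h' => hrt (lt_trans ?_ hst)⟩
        exact h'.2
  · symm
    refine Finset.card_nbij (fun i => (i, ⟨t, ht⟩)) ?_ ?_ ?_
    · intro i hi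
      have hi := (Finset.mem_filter.1 hi).2
      refine Finset.mem_filter.2 ⟨Finset.mem_filter.2 ⟨mem_boardSq_truncBoard.2 ?_, hi.2⟩, ?_⟩
      · exact ⟨t.lt_succ_self, hi.1⟩
      · exact lt_irrefl t
    · intro i _ i' _ h
      exact (Prod.ext_iff.1 h).1
    · rintro ⟨i, j⟩ hs
      simp only [Finset.coe_filter, Finset.mem_filter, Set.mem_ofPred_eq,
        mem_boardSq_truncBoard] at hs
      obtain ⟨⟨⟨h1, h2⟩, h3⟩, h4⟩ := hs
      obtain rfl : j = ⟨t, ht⟩ := Fin.ext (by simp only; omega)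
      exact ⟨i, Finset.mem_filter.2 ⟨Finset.mem_univ _, h2, h3⟩, rfl⟩

lemma rookInv_of_subset (c : ℕ → ℕ) {n t : ℕ} (ht : t < n) {C : Finset (Fin n × Fin n)}
    (hC : C ⊆ boardSq n (truncBoard c n t)) :
    rookInv n (truncBoard c n (t + 1)) C =
      rookInv n (truncBoard c n t) C + (openRows c t C).card := by
  have hlt : ∀ r ∈ C, (r.2 : ℕ) < t := fun r hr => (mem_boardSq_truncBoard.1 (hC hr)).1
  rw [rookInv_truncBoard_succ c ht, Finset.filter_true_of_mem hlt, openRows]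
  congr 2
  ext i
  simp only [Finset.mem_filter, Finset.mem_univ, true_and]
  refine and_congr_right fun _ => ⟨fun h r hr e => (h.2 r hr).2 ⟨e, hlt r hr⟩, fun h => ?_⟩
  exact ⟨fun hi => h _ hi rfl, fun r hr =>
    ⟨fun h' => (hlt r hr).ne (congrArg Fin.val h'.1), fun h' => h r hr h'.1⟩⟩

lemma rookInv_insert (c : ℕ → ℕ) {n t : ℕ} (ht : t < n) {C : Finset (Fin n × Fin n)}
    (hC : C ⊆ boardSq n (truncBoard c n t)) {i : Fin n} :
    rookInv n (truncBoard c n (t + 1)) (insert (i, ⟨t, ht⟩) C) =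
      rookInv n (truncBoard c n t) C + ((openRows c t C).filter fun a => i < a).card := by
  have hlt : ∀ r ∈ C, (r.2 : ℕ) < t := fun r hr => (mem_boardSq_truncBoard.1 (hC hr)).1
  rw [rookInv_truncBoard_succ c ht, Finset.filter_insert, if_neg (by simp),
    Finset.filter_true_of_mem hlt, openRows]
  congr 2
  ext a
  simp only [Finset.mem_filter, Finset.mem_univ, true_and, and_assoc]
  refine and_congr_right fun _ => ⟨fun h => ?_, fun h => ?_⟩
  · have h1 := (h.2 _ (Finset.mem_insert_self _ _)).1
    have h2 : a ≠ i := fun e => h.1 (e ▸ Finset.mem_insert_self _ _)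
    exact ⟨fun r hr e => (h.2 r (Finset.mem_insert_of_mem hr)).2 ⟨e, hlt r hr⟩,
      lt_of_le_of_ne (not_lt.1 fun h' => h1 ⟨rfl, h'⟩) h2.symm⟩
  · refine ⟨fun ha => ?_, fun r hr => ?_⟩
    · rcases Finset.mem_insert.1 ha with ha | ha
      · exact h.2.ne' (Prod.ext_iff.1 ha).1
      · exact h.1 _ ha rfl
    · rcases Finset.mem_insert.1 hr with rfl | hr
      · exact ⟨fun h' => h.2.not_gt h'.2, fun h' => lt_irrefl _ h'.2⟩
      · exact ⟨fun h' => (hlt r hr).ne (congrArg Fin.val h'.1), fun h' => h.1 r hr h'.1⟩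

lemma placements_filter_column (c : ℕ → ℕ) {n t : ℕ} (k : ℕ) :
    (placements n (truncBoard c n (t + 1)) k).filter (fun C => ∀ r ∈ C, (r.2 : ℕ) ≠ t) =
      placements n (truncBoard c n t) k := by
  ext C
  simp only [placements, Finset.mem_filter, Finset.mem_univ, true_and]
  constructor
  · rintro ⟨⟨hk, hb, ha⟩, h⟩
    refine ⟨hk, fun r hr => ?_, ha⟩
    have h1 := mem_boardSq_truncBoard.1 (hb hr)
    have h2 := h r hr
    exact mem_boardSq_truncBoard.2 ⟨by omega, h1.2⟩
  · rintro ⟨hk, hb, ha⟩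
    refine ⟨⟨hk, fun r hr => ?_, ha⟩, fun r hr => (mem_boardSq_truncBoard.1 (hb hr)).1.ne⟩
    have h1 := mem_boardSq_truncBoard.1 (hb hr)
    exact mem_boardSq_truncBoard.2 ⟨by omega, h1.2⟩

lemma insert_mem_placements {c : ℕ → ℕ} {n t k : ℕ} (ht : t < n) {C : Finset (Fin n × Fin n)}
    (hC : C ∈ placements n (truncBoard c n t) k) {i : Fin n} (hi : i ∈ openRows c t C) :
    insert (i, ⟨t, ht⟩) C ∈ placements n (truncBoard c n (t + 1)) (k + 1) := by
  simp only [placements, openRows, Finset.mem_filter, Finset.mem_univ, true_and] at hC hi ⊢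
  obtain ⟨hk, hb, ha⟩ := hC
  have hlt : ∀ r ∈ C, (r.2 : ℕ) < t := fun r hr => (mem_boardSq_truncBoard.1 (hb hr)).1
  have hne : ∀ r ∈ C, r.2 ≠ ⟨t, ht⟩ := fun r hr e => (hlt r hr).ne (congrArg Fin.val e)
  refine ⟨?_, fun r hr => ?_, fun r hr r' hr' h => ?_⟩
  · rw [Finset.card_insert_of_notMem (fun h => hne _ h rfl), hk]
  · rcases Finset.mem_insert.1 hr with rfl | hr
    · exact mem_boardSq_truncBoard.2 ⟨t.lt_succ_self, hi.1⟩
    · have h1 := mem_boardSq_truncBoard.1 (hb hr)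
      exact mem_boardSq_truncBoard.2 ⟨by omega, h1.2⟩
  · rcases Finset.mem_insert.1 hr with rfl | hr <;> rcases Finset.mem_insert.1 hr' with rfl | hr'
    · exact absurd rfl h
    · exact ⟨(hi.2 r' hr').symm, (hne r' hr').symm⟩
    · exact ⟨hi.2 r hr, hne r hr⟩
    · exact ha r hr r' hr' h

lemma exists_eq_insert {c : ℕ → ℕ} {n t k : ℕ} (ht : t < n) {D : Finset (Fin n × Fin n)}
    (hD : D ∈ placements n (truncBoard c n (t + 1)) (k + 1)) (h : ∃ r ∈ D, (r.2 : ℕ) = t) :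
    ∃ C ∈ placements n (truncBoard c n t) k, ∃ i ∈ openRows c t C,
      insert (i, ⟨t, ht⟩) C = D := by
  obtain ⟨⟨i, j⟩, hr, hj⟩ := h
  obtain rfl : j = ⟨t, ht⟩ := Fin.ext hj
  simp only [placements, openRows, Finset.mem_filter, Finset.mem_univ, true_and] at hD ⊢
  obtain ⟨hk, hb, ha⟩ := hD
  refine ⟨D.erase (i, ⟨t, ht⟩), ⟨by rw [Finset.card_erase_of_mem hr, hk]; rfl, fun r h => ?_,
    fun r h r' h' => ha r (Finset.mem_of_mem_erase h) r' (Finset.mem_of_mem_erase h')⟩, i,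
    ⟨(mem_boardSq_truncBoard.1 (hb hr)).2, fun r h =>
      (ha r (Finset.mem_of_mem_erase h) _ hr (Finset.ne_of_mem_erase h)).1⟩,
    Finset.insert_erase hr⟩
  have h1 := mem_boardSq_truncBoard.1 (hb (Finset.mem_of_mem_erase h))
  have h2 := (ha r (Finset.mem_of_mem_erase h) _ hr (Finset.ne_of_mem_erase h)).2
  have h3 : (r.2 : ℕ) ≠ t := fun e => h2 (Fin.ext e)
  exact mem_boardSq_truncBoard.2 ⟨by omega, h1.2⟩

theorem qRook_truncBoard {c : ℕ → ℕ} (hc : Monotone c) {n : ℕ} (hn : ∀ j, c j ≤ n) {t : ℕ}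
    (ht : t ≤ n) (k : ℕ) : qRook q n (truncBoard c n t) k = rookRec q c t k := by
  induction t generalizing k with
  | zero =>
    have hb : boardSq n (truncBoard c n 0) = ∅ := by
      ext s; simp [mem_boardSq_truncBoard]
    cases k with
    | zero =>
      have hp : placements n (truncBoard c n 0) 0 = {∅} := by
        ext C
        simp only [placements, hb, Finset.mem_filter, Finset.mem_univ, true_and,
          Finset.subset_empty, Finset.mem_singleton]
        constructor
        · exact fun h => h.2.1
        · rintro rfl; simp [NonAttacking]
      simp [qRook, hp, rookInv, hb, rookRec]
    | succ k =>
      have hp : placements n (truncBoard c n 0) (k + 1) = ∅ := by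
        ext C
        simp only [placements, hb, Finset.mem_filter, Finset.mem_univ, true_and,
          Finset.subset_empty, Finset.notMem_empty, iff_false]
        rintro ⟨h, rfl, _⟩
        simp at h
      simp [qRook, hp, rookRec]
  | succ t ih =>
    have ht' : t < n := ht
    have hsub {k C} (hC : C ∈ placements n (truncBoard c n t) k) :
        C ⊆ boardSq n (truncBoard c n t) := (Finset.mem_filter.1 hC).2.2.1
    have h1 (k : ℕ) : ∑ C ∈ placements n (truncBoard c n t) k,
        q ^ rookInv n (truncBoard c n (t + 1)) C = q ^ (c t - k) * rookRec q c t k := by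
      rw [← ih ht'.le, qRook, Finset.mul_sum]
      refine Finset.sum_congr rfl fun C hC => ?_
      rw [rookInv_of_subset c ht' (hsub hC), card_openRows hc (hn t) hC, pow_add, mul_comm]
    rw [qRook, ← Finset.sum_filter_add_sum_filter_not _ (fun C => ∀ r ∈ C, (r.2 : ℕ) ≠ t),
      placements_filter_column, h1]
    cases k with
    | zero =>
      rw [Finset.sum_eq_zero, rookRec, Nat.sub_zero, add_zero]
      intro C hC
      simp only [placements, Finset.mem_filter, Finset.card_eq_zero] at hC
      obtain ⟨⟨_, rfl, _⟩, h⟩ := hC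
      simp at h
    | succ k =>
      rw [rookRec]
      congr 1
      rw [← ih ht'.le, qRook, Finset.mul_sum]
      have h2 : ∀ C ∈ placements n (truncBoard c n t) k,
          qint q (c t - k) * q ^ rookInv n (truncBoard c n t) C =
            ∑ i ∈ openRows c t C,
              q ^ rookInv n (truncBoard c n (t + 1)) (insert (i, ⟨t, ht'⟩) C) := by
        intro C hC
        rw [← card_openRows hc (hn t) hC, ← sum_pow_card_filter_lt q (openRows c t C),
          Finset.sum_mul]
        refine Finset.sum_congr rfl fun i _ => ?_
        rw [rookInv_insert c ht' (hsub hC), pow_add, mul_comm]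
      rw [Finset.sum_congr rfl h2, Finset.sum_sigma']
      symm
      refine Finset.sum_bij (fun (p : Σ _ : Finset (Fin n × Fin n), Fin n) _ =>
        insert (p.2, (⟨t, ht'⟩ : Fin n)) p.1) ?_ ?_ ?_ ?_
      · rintro ⟨C, i⟩ h
        rw [Finset.mem_sigma] at h
        refine Finset.mem_filter.2 ⟨insert_mem_placements ht' h.1 h.2, fun h' => ?_⟩
        exact h' _ (Finset.mem_insert_self _ _) rfl
      · rintro ⟨C, i⟩ h ⟨C', i'⟩ h' e
        rw [Finset.mem_sigma] at h h'
        have hn1 (a) : (a, (⟨t, ht'⟩ : Fin n)) ∉ C := fun hm =>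
          lt_irrefl t (mem_boardSq_truncBoard.1 (hsub h.1 hm)).1
        have hn2 (a) : (a, (⟨t, ht'⟩ : Fin n)) ∉ C' := fun hm =>
          lt_irrefl t (mem_boardSq_truncBoard.1 (hsub h'.1 hm)).1
        simp only at e
        have hi : i = i' := by
          have hm : (i, (⟨t, ht'⟩ : Fin n)) ∈ insert (i', (⟨t, ht'⟩ : Fin n)) C' :=
            e ▸ Finset.mem_insert_self _ _
          rcases Finset.mem_insert.1 hm with hm | hm
          · exact (Prod.ext_iff.1 hm).1
          · exact absurd hm (hn2 i)
        subst hi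
        have hCC : C = C' := by
          rw [← Finset.erase_insert (hn1 i), e, Finset.erase_insert (hn2 i)]
        rw [hCC]
      · intro D hD
        rw [Finset.mem_filter] at hD
        obtain ⟨C, hC, i, hi, e⟩ := exists_eq_insert ht' hD.1 (by simpa using hD.2)
        exact ⟨⟨C, i⟩, Finset.mem_sigma.2 ⟨hC, hi⟩, e⟩
      · rintro ⟨C, i⟩ _
        rfl

lemma eval_hitGen {c : ℕ → ℕ} (hc : Monotone c) {n : ℕ} (hn : ∀ j, c j ≤ n) (x : R) :
    (hitGen q n fun j : Fin n => c j).eval x = hitEval q c n x := by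
  have htr : truncBoard c n n = fun j : Fin n => c j := by
    funext j; simp [truncBoard]
  simp only [hitGen, hitEval, Polynomial.eval_finsetSum, Polynomial.eval_mul, Polynomial.eval_C,
    Polynomial.eval_prod, Polynomial.eval_sub, Polynomial.eval_X, ← htr,
    qRook_truncBoard q hc hn le_rfl]

end RookPlacements

theorem statement8 (q : ℚ) (hq : q ≠ 0) (n : ℕ) (c : Fin n → ℕ)
    (hc : IsFerrers n c) (k : ℕ) :
    qHit q n c k =
      ∑ C ∈ fullPlacements n c k,
        q ^ ((n : ℤ) * ((n : ℤ) - k) + (∑ j, (c j : ℤ)) - crossStat n c C) := by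
  obtain ⟨d, hd, hdn, rfl⟩ : ∃ d : ℕ → ℕ, Monotone d ∧ (∀ j, d j ≤ n) ∧
      c = fun j : Fin n => d j := by
    refine ⟨fun j => if h : j < n then c ⟨j, h⟩ else n, fun a b hab => ?_, fun j => ?_, ?_⟩
    · simp only
      split_ifs with h1 h2 h2
      · exact hc.1 hab
      · exact hc.2 _
      · omega
      · rfl
    · simp only
      split_ifs
      · exact hc.2 _
      · rfl
    · funext j; simp
  have key : hitGen q n (fun j => d j) = ∑ σ : Equiv.Perm (Fin n),
      Polynomial.monomial (onBoard d σ)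
        (q ^ ((uncrossed d σ : ℤ) + ((∑ j : Fin n, d j : ℕ) : ℤ) - n * onBoard d σ)) := by
    refine Polynomial.funext fun x => ?_
    rw [eval_hitGen q hd hdn, hitEval_eq_sum_perm hq hd hdn, Polynomial.eval_finsetSum]
    refine Finset.sum_congr rfl fun σ _ => ?_
    rw [Polynomial.eval_monomial, mul_comm]
  rw [qHit, key, Polynomial.finsetSum_coeff, sum_fullPlacements, Finset.sum_filter]
  refine Finset.sum_congr rfl fun σ _ => ?_
  rw [Polynomial.coeff_monomial]
  split_ifs with h
  · congr 1
    have hx := congrArg (Nat.cast : ℕ → ℤ) (crossStat_add_uncrossed d σ)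
    push_cast at hx ⊢
    rw [h]
    linarith
  · rfl
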